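/- Let G be a simple graph on a finite vertex type and let e = uv be an edge of G. Then the permanental polynomial of the Laplacian matrix satisfies ψ(L(G)) = ψ(L(G − e)) − ψ(L_v(G − e)) − ψ(L_u(G − e)) + 2·ψ(L_{uv}(G)) + 2·Σ_{C ∈ 𝔠_G(e)} ψ(L_{V(C)}(G)). -/

import Mathlib

open Polynomial Matrix

attribute [local instance] Classical.propDecidable

noncomputable section

/-- The permanent of a square matrix: `per M = ∑_{σ} ∏_i M i (σ i)`. -/
def Matrix.per {n R : Type*} [Fintype n] [DecidableEq n] [CommRing R]
    (M : Matrix n n R) : R :=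
  ∑ σ : Equiv.Perm n, ∏ i, M i (σ i)

/-- The characteristic polynomial `φ(M) = det (x·I - M)`. -/
def phi {n R : Type*} [Fintype n] [DecidableEq n] [CommRing R]
    (M : Matrix n n (Polynomial R)) : Polynomial R :=
  ((Polynomial.X : Polynomial R) • (1 : Matrix n n (Polynomial R)) - M).det

/-- The permanental polynomial `ψ(M) = per (x·I - M)`. -/
def psi {n R : Type*} [Fintype n] [DecidableEq n] [CommRing R]
    (M : Matrix n n (Polynomial R)) : Polynomial R :=
  ((Polynomial.X : Polynomial R) • (1 : Matrix n n (Polynomial R)) - M).per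

variable {V : Type*}

/-- The principal submatrix of `M` obtained by deleting the rows and columns indexed by `S`. -/
def delSub {R : Type*} (M : Matrix V V R) (S : Set V) :
    Matrix {w : V // w ∉ S} {w : V // w ∉ S} R :=
  M.submatrix Subtype.val Subtype.val

/-- `C` is a cycle of `G`: a subgraph of `G` that is connected, has nonempty vertex set,
and in which every vertex of `C` has degree exactly `2` in `C`. -/
def IsCycleSub (G : SimpleGraph V) (C : G.Subgraph) : Prop :=
  C.Connected ∧ C.verts.Nonempty ∧ ∀ w ∈ C.verts, (C.neighborSet w).ncard = 2

variable [Fintype V] [DecidableEq V]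

/-- The degree diagonal matrix `D(G)` of a graph. -/
def degMat (R : Type*) [CommRing R] (G : SimpleGraph V) [DecidableRel G.Adj] :
    Matrix V V R :=
  Matrix.diagonal fun w => (G.degree w : R)

/-- The Laplacian matrix `L(G) = D(G) - A(G)`. -/
def lapMat (R : Type*) [CommRing R] (G : SimpleGraph V) [DecidableRel G.Adj] :
    Matrix V V R :=
  degMat R G - G.adjMatrix R


/-- Sum over permutations with prescribed values on `S`. -/
theorem aux_per_delSub {W R : Type*} [Fintype W] [DecidableEq W] [CommRing R]
    (M : Matrix W W R) (S : Set W) [Fintype {w : W // w ∉ S}] [DecidableEq {w : W // w ∉ S}]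
    (τ : Equiv.Perm W) [DecidablePred fun i => i ∉ S]
    [DecidablePred fun σ : Equiv.Perm W => ∀ i ∈ S, σ i = τ i]
    (hτ : ∀ i, i ∉ S → τ i = i) :
    (∑ σ : Equiv.Perm W, if (∀ i ∈ S, σ i = τ i) then
      ∏ i ∈ Finset.univ.filter (fun i => i ∉ S), M i (σ i) else 0) = (delSub M S).per := by
  classical
  rw [← Finset.sum_filter, Matrix.per]
  symm
  refine Finset.sum_bij (fun ρ _ => τ * Equiv.Perm.ofSubtype ρ) ?_ ?_ ?_ ?_
  · intro ρ _
    simp only [Finset.mem_filter, Finset.mem_univ, true_and]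
    intro i hi
    rw [Equiv.Perm.mul_apply, Equiv.Perm.ofSubtype_apply_of_not_mem]
    simpa using hi
  · intro a _ b _ h
    exact Equiv.Perm.ofSubtype_injective (mul_left_cancel h)
  · intro σ hσ
    simp only [Finset.mem_filter, Finset.mem_univ, true_and] at hσ
    have hfix : ∀ a, ¬ (a ∉ S) → (τ⁻¹ * σ) a = a := by
      intro a ha
      rw [not_not] at ha
      rw [Equiv.Perm.mul_apply, hσ a ha]
      simp
    refine ⟨(Equiv.Perm.subtypeEquivSubtypePerm (fun w => w ∉ S)).symm ⟨τ⁻¹ * σ, hfix⟩,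
      Finset.mem_univ _, ?_⟩
    have h := (Equiv.Perm.subtypeEquivSubtypePerm (fun w => w ∉ S)).apply_symm_apply
      ⟨τ⁻¹ * σ, hfix⟩
    have h2 := congrArg Subtype.val h
    change τ * (((Equiv.Perm.subtypeEquivSubtypePerm (fun w => w ∉ S))
      ((Equiv.Perm.subtypeEquivSubtypePerm (fun w => w ∉ S)).symm ⟨τ⁻¹ * σ, hfix⟩)).1) = σ
    rw [h2]
    simp
  · intro ρ _
    rw [← Finset.prod_subtype_of_mem (p := fun i => i ∉ S)
      (f := fun i => M i ((τ * Equiv.Perm.ofSubtype ρ) i)) (by simp)]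
    refine Finset.prod_bij (fun a _ => a) ?_ ?_ ?_ ?_
    · intro a _; simp [a.2]
    · intro a _ b _ h; exact h
    · intro b _; exact ⟨b, Finset.mem_univ _, rfl⟩
    · intro a _
      simp only [delSub, Matrix.submatrix_apply, Equiv.Perm.mul_apply,
        Equiv.Perm.ofSubtype_apply_coe]
      rw [hτ _ (ρ a).2]

theorem aux_cycleOf_iff {W : Type*} [Fintype W] [DecidableEq W] (σ τ : Equiv.Perm W) (u : W)
    [DecidableRel σ.SameCycle]
    (hτ : τ.IsCycle) (hu : τ u ≠ u) :
    σ.cycleOf u = τ ↔ ∀ i ∈ τ.support, σ i = τ i := by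
  constructor
  · rintro rfl i hi
    rw [Equiv.Perm.mem_support, Equiv.Perm.cycleOf_apply] at hi
    rw [Equiv.Perm.cycleOf_apply]
    split_ifs at hi ⊢ with h
    · rfl
    · exact absurd rfl hi
  · intro h
    have := Equiv.Perm.cycle_is_cycleOf (f := σ) (Equiv.Perm.mem_support.2 hu)
      (Equiv.Perm.mem_cycleFactorsFinset_iff.2 ⟨hτ, fun a ha => (h a ha).symm⟩)
    rw [this]
    congr!

/-- the set of directed cycles through `u → v` -/
def dirCycles {W : Type*} [Fintype W] [DecidableEq W] (G : SimpleGraph W) (u v : W) :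
    Set (Equiv.Perm W) :=
  {τ | τ.IsCycle ∧ τ u = v ∧ τ v ≠ u ∧ ∀ i ∈ τ.support, G.Adj i (τ i)}

theorem aux_sum_dir {W R : Type*} [Fintype W] [DecidableEq W] [CommRing R]
    (G : SimpleGraph W) (M : Matrix W W R)
    (hM : ∀ i j, i ≠ j → M i j = if G.Adj i j then 1 else 0) (u v : W) (huv : u ≠ v) :
    (∑ σ : Equiv.Perm W, if (σ u = v ∧ σ v ≠ u) then ∏ i, M i (σ i) else 0) =
      ∑ τ ∈ Finset.univ.filter (fun τ => τ ∈ dirCycles G u v),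
        (delSub M (τ.support : Set W)).per := by
  classical
  rw [← Finset.sum_filter]
  rw [← Finset.sum_fiberwise_of_maps_to (g := fun σ => σ.cycleOf u)
    (t := Finset.univ.filter (fun τ : Equiv.Perm W => τ.IsCycle ∧ τ u = v ∧ τ v ≠ u))]
  · have key : ∀ τ ∈ Finset.univ.filter (fun τ : Equiv.Perm W => τ.IsCycle ∧ τ u = v ∧ τ v ≠ u),
        (∑ σ ∈ (Finset.univ.filter (fun σ : Equiv.Perm W => σ u = v ∧ σ v ≠ u)).filter
          (fun σ => σ.cycleOf u = τ), ∏ i, M i (σ i)) =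
        if (∀ i ∈ τ.support, G.Adj i (τ i)) then (delSub M (τ.support : Set W)).per else 0 := by
      intro τ hτ
      simp only [Finset.mem_filter, Finset.mem_univ, true_and] at hτ
      obtain ⟨hc, h1, h2⟩ := hτ
      have hu : τ u ≠ u := by rw [h1]; exact huv.symm
      have hv : τ v ≠ v := by
        intro h
        exact huv (τ.injective (h1.trans h.symm))
      rw [Finset.filter_filter]
      have e1 : Finset.univ.filter (fun σ : Equiv.Perm W => (σ u = v ∧ σ v ≠ u) ∧ σ.cycleOf u = τ)
          = Finset.univ.filter (fun σ : Equiv.Perm W => ∀ i ∈ (τ.support : Set W), σ i = τ i) := by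
        ext σ
        simp only [Finset.mem_filter, Finset.mem_univ, true_and]
        rw [aux_cycleOf_iff σ τ u hc hu]
        simp only [Finset.mem_coe]
        constructor
        · exact fun h => h.2
        · intro h
          refine ⟨⟨?_, ?_⟩, h⟩
          · rw [h u (Equiv.Perm.mem_support.2 hu), h1]
          · rw [h v (Equiv.Perm.mem_support.2 hv)]; exact h2
      rw [e1]
      have e2 : ∀ σ ∈ Finset.univ.filter
          (fun σ : Equiv.Perm W => ∀ i ∈ (τ.support : Set W), σ i = τ i),
          ∏ i, M i (σ i) = (if (∀ i ∈ τ.support, G.Adj i (τ i)) then 1 else 0) *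
            ∏ i ∈ Finset.univ.filter (fun i => i ∉ (τ.support : Set W)), M i (σ i) := by
        intro σ hσ
        simp only [Finset.mem_filter, Finset.mem_univ, true_and] at hσ
        rw [← Finset.prod_filter_mul_prod_filter_not Finset.univ
          (fun i => i ∈ (τ.support : Set W))]
        congr 1
        have e3 : Finset.univ.filter (fun i => i ∈ (τ.support : Set W)) = τ.support := by
          ext i; simp
        rw [e3]
        have e4 : ∀ i ∈ τ.support, M i (σ i) = if G.Adj i (τ i) then 1 else 0 := by
          intro i hi
          rw [hσ i hi, hM]
          exact (Equiv.Perm.mem_support.1 hi).symm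
        rw [Finset.prod_congr rfl e4]
        split_ifs with h
        · exact Finset.prod_eq_one (fun i hi => by simp [h i hi])
        · push Not at h
          obtain ⟨i, hi, hn⟩ := h
          exact Finset.prod_eq_zero hi (by simp [hn])
      rw [Finset.sum_congr rfl e2, ← Finset.mul_sum, Finset.sum_filter]
      rw [aux_per_delSub M (τ.support : Set W) τ
        (fun i hi => by simpa using hi)]
      split_ifs <;> simp
    rw [Finset.sum_congr rfl key, ← Finset.sum_filter, Finset.filter_filter]
    refine Finset.sum_congr ?_ fun _ _ => rfl
    ext τ
    simp only [Finset.mem_filter, Finset.mem_univ, true_and]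
    exact ⟨fun h => ⟨h.1.1, h.1.2.1, h.1.2.2, h.2⟩, fun h => ⟨⟨h.1, h.2.1, h.2.2.1⟩, h.2.2.2⟩⟩
  · intro σ hσ
    simp only [Finset.mem_filter, Finset.mem_univ, true_and] at hσ ⊢
    obtain ⟨h1, h2⟩ := hσ
    refine ⟨Equiv.Perm.isCycle_cycleOf _ (by rw [h1]; exact huv.symm), ?_, ?_⟩
    · rw [Equiv.Perm.cycleOf_apply_self, h1]
    · have : σ.SameCycle u v := ⟨1, by simpa using h1⟩
      rw [Equiv.Perm.SameCycle.cycleOf_apply this]; exact h2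

/-- the subgraph traced by a permutation -/
def permSub {W : Type*} [Fintype W] [DecidableEq W] (G : SimpleGraph W) (τ : Equiv.Perm W) :
    G.Subgraph where
  verts := (τ.support : Set W)
  Adj a b := G.Adj a b ∧ (τ a = b ∨ τ b = a)
  adj_sub h := h.1
  edge_vert := by
    rintro a b ⟨h, h1⟩
    rw [Finset.mem_coe, Equiv.Perm.mem_support]
    intro h2
    rcases h1 with h1 | h1
    · exact h.ne (h2.symm.trans h1)
    · exact h.ne (τ.injective (h2.trans h1.symm))
  symm := ⟨fun a b h => ⟨h.1.symm, h.2.symm⟩⟩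

theorem permSub_nbr {W : Type*} [Fintype W] [DecidableEq W] (G : SimpleGraph W)
    (τ : Equiv.Perm W) (hadj : ∀ i ∈ τ.support, G.Adj i (τ i)) (a : W) (ha : a ∈ τ.support) :
    (permSub G τ).neighborSet a = {τ a, τ⁻¹ a} := by
  ext b
  rw [SimpleGraph.Subgraph.mem_neighborSet]
  change (G.Adj a b ∧ (τ a = b ∨ τ b = a)) ↔ _
  simp only [Set.mem_insert_iff, Set.mem_singleton_iff, Equiv.Perm.eq_inv_iff_eq]
  constructor
  · rintro ⟨_, h | h⟩
    · exact Or.inl h.symm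
    · exact Or.inr h
  · rintro (h | h)
    · subst h; exact ⟨hadj a ha, Or.inl rfl⟩
    · subst h
      exact ⟨(hadj b (Equiv.Perm.apply_mem_support.1 ha)).symm, Or.inr rfl⟩

theorem aux_sq_ne {W : Type*} [Fintype W] [DecidableEq W]
    (τ : Equiv.Perm W) (hc : τ.IsCycle) {u : W} (hu : τ (τ u) ≠ u) (a : W)
    (ha : a ∈ τ.support) : τ a ≠ τ⁻¹ a := by
  intro h
  have h' : (τ ^ 2) a = a := by
    rw [pow_two, Equiv.Perm.mul_apply, h]; simp
  have hu' : τ u ≠ u := by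
    intro h3; exact hu (by rw [h3, h3])
  obtain ⟨n, hn⟩ := hc.exists_pow_eq (Equiv.Perm.mem_support.1 ha) hu'
  apply hu
  have : (τ ^ 2) ((τ ^ n) a) = (τ ^ n) a := by
    rw [← Equiv.Perm.mul_apply, ← pow_add, add_comm, pow_add, Equiv.Perm.mul_apply, h']
  rw [hn, pow_two] at this
  exact this

theorem permSub_isCycle {W : Type*} [Fintype W] [DecidableEq W] (G : SimpleGraph W)
    (u v : W) (huv : u ≠ v) (τ : Equiv.Perm W) (hτ : τ ∈ dirCycles G u v) :
    IsCycleSub G (permSub G τ) ∧ (permSub G τ).Adj u v := by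
  obtain ⟨hc, h1, h2, hadj⟩ := hτ
  have hu : τ u ≠ u := by rw [h1]; exact huv.symm
  have hus : u ∈ τ.support := Equiv.Perm.mem_support.2 hu
  have hA : (permSub G τ).Adj u v := ⟨h1 ▸ hadj u hus, Or.inl h1⟩
  refine ⟨⟨?_, ⟨u, hus⟩, ?_⟩, hA⟩
  · rw [SimpleGraph.Subgraph.connected_iff']
    have hp : ∀ n : ℕ, (τ ^ n) u ∈ (permSub G τ).verts := fun n =>
      Equiv.Perm.pow_apply_mem_support.2 hus
    have hr : ∀ n : ℕ, (permSub G τ).coe.Reachable ⟨u, hus⟩ ⟨(τ ^ n) u, hp n⟩ := by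
      intro n
      induction n with
      | zero => exact SimpleGraph.Reachable.refl _
      | succ n ih =>
        refine ih.trans (SimpleGraph.Adj.reachable ?_)
        rw [SimpleGraph.Subgraph.coe_adj]
        change G.Adj ((τ ^ n) u) ((τ ^ (n+1)) u) ∧
          (τ ((τ ^ n) u) = (τ ^ (n+1)) u ∨ τ ((τ ^ (n+1)) u) = (τ ^ n) u)
        rw [pow_succ', Equiv.Perm.mul_apply]
        exact ⟨hadj _ (hp n), Or.inl rfl⟩
    have hr' : ∀ w, (permSub G τ).coe.Reachable ⟨u, hus⟩ w := by
      rintro ⟨w, hw⟩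
      obtain ⟨n, hn⟩ := hc.exists_pow_eq hu (Equiv.Perm.mem_support.1 hw)
      subst hn
      exact hr n
    have : Nonempty (permSub G τ).verts := ⟨⟨u, hus⟩⟩
    exact SimpleGraph.Connected.mk fun a b => (hr' a).symm.trans (hr' b)
  · intro w hw
    rw [permSub_nbr G τ hadj w hw, Set.ncard_pair]
    exact aux_sq_ne τ hc (u := u) (by rw [h1]; exact h2) w hw

theorem permSub_injOn {W : Type*} [Fintype W] [DecidableEq W] (G : SimpleGraph W)
    (u v : W) (huv : u ≠ v) : Set.InjOn (permSub G) (dirCycles G u v) := by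
  rintro τ ⟨hc, h1, h2, hadj⟩ ρ ⟨hc', h1', h2', hadj'⟩ heq
  have hsup : τ.support = ρ.support := by
    have := congrArg SimpleGraph.Subgraph.verts heq
    exact Finset.coe_injective this
  have hu : τ u ≠ u := by rw [h1]; exact huv.symm
  have hus : u ∈ τ.support := Equiv.Perm.mem_support.2 hu
  have step : ∀ n : ℕ, (τ ^ n) u = (ρ ^ n) u ∧ (τ ^ (n+1)) u = (ρ ^ (n+1)) u := by
    intro n
    induction n with
    | zero => simp [h1, h1']
    | succ n ih =>
      refine ⟨ih.2, ?_⟩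
      set b := (τ ^ (n+1)) u with hb
      have hbs : b ∈ τ.support := Equiv.Perm.pow_apply_mem_support.2 hus
      have hN : (permSub G τ).neighborSet b = (permSub G ρ).neighborSet b := by rw [heq]
      rw [permSub_nbr G τ hadj b hbs, permSub_nbr G ρ hadj' b (hsup ▸ hbs)] at hN
      have i1 : τ⁻¹ b = (τ ^ n) u := by
        rw [hb, pow_succ', Equiv.Perm.mul_apply]; simp
      have i2 : ρ⁻¹ b = (ρ ^ n) u := by
        rw [ih.2, pow_succ', Equiv.Perm.mul_apply]; simp
      have ne1 : τ b ≠ τ⁻¹ b := aux_sq_ne τ hc (u := u) (by rw [h1]; exact h2) b hbs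
      have hmem : τ b ∈ ({ρ b, ρ⁻¹ b} : Set W) := hN ▸ Set.mem_insert _ _
      rw [pow_succ', Equiv.Perm.mul_apply, ← hb, pow_succ' ρ, Equiv.Perm.mul_apply, ← ih.2]
      rcases hmem with h | h
      · exact h
      · exact absurd (h.trans (i2.trans (ih.1.symm.trans i1.symm))) ne1
  ext w
  by_cases hw : w ∈ τ.support
  · obtain ⟨n, hn⟩ := hc.exists_pow_eq hu (Equiv.Perm.mem_support.1 hw)
    have e1 := (step n).1
    have e2 := (step n).2
    rw [pow_succ', Equiv.Perm.mul_apply, pow_succ' ρ, Equiv.Perm.mul_apply, ← e1, hn] at e2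
    exact e2
  · have hw' : w ∉ ρ.support := hsup ▸ hw
    rw [Equiv.Perm.notMem_support.1 hw, Equiv.Perm.notMem_support.1 hw']

theorem aux_exists_perm {W : Type*} [Fintype W] [DecidableEq W] (G : SimpleGraph W)
    (C : G.Subgraph) (hC : IsCycleSub G C) (u : W) (hu : u ∈ C.verts) :
    ∃ τ : Equiv.Perm W, τ.IsCycle ∧ (τ.support : Set W) = C.verts ∧
      (∀ i ∈ τ.support, C.Adj i (τ i)) ∧ τ (τ u) ≠ u := by
  obtain ⟨hconn, -, hdeg⟩ := hC
  have hcyc : C.spanningCoe.IsCycles := by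
    rintro a ⟨b, hb⟩
    exact hdeg a (C.edge_vert hb)
  have hne : (C.spanningCoe.neighborSet u).Nonempty := by
    have := hdeg u hu
    exact Set.nonempty_of_ncard_ne_zero (s := C.neighborSet u) (by omega)
  obtain ⟨p, hp, hpv⟩ := hcyc.exists_cycle_toSubgraph_verts_eq_connectedComponentSupp
    (c := C.spanningCoe.connectedComponentMk u) (v := u) rfl hne
  have hlen : 3 ≤ p.length := hp.three_le_length
  set l := p.support.tail with hl
  have hnd : l.Nodup := hp.support_nodup
  have hll : l.length = p.length := by simp [hl]
  have hget : ∀ (i : ℕ) (hi : i < l.length), l[i] = p.getVert (i + 1) := by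
    intro i hi
    rw [SimpleGraph.Walk.getVert_eq_support_getElem p (by omega)]
    simp [hl]
  have hsupp : l.formPerm.support = l.toFinset := by
    apply List.support_formPerm_of_nodup l hnd
    intro x hx
    rw [hx] at hll
    simp at hll
    omega
  have hadj : ∀ i ∈ l.formPerm.support, C.Adj i (l.formPerm i) := by
    intro x hx
    rw [hsupp, List.mem_toFinset] at hx
    obtain ⟨i, hi, rfl⟩ := List.getElem_of_mem hx
    rw [List.formPerm_apply_getElem l hnd i hi, hget, hget]
    by_cases h : i + 1 = l.length
    · have e : (i + 1) % l.length = 0 := by rw [h]; simp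
      rw [e, h, hll, SimpleGraph.Walk.getVert_length]
      have := p.adj_getVert_succ (i := 0) (by omega)
      rw [SimpleGraph.Walk.getVert_zero] at this
      exact this
    · rw [Nat.mod_eq_of_lt (by omega)]
      exact p.adj_getVert_succ (by omega)
  have hmem : ∀ w ∈ C.verts, w ∈ l := by
    intro w hw
    have hr : C.spanningCoe.Reachable w u := by
      have := (SimpleGraph.Subgraph.connected_iff'.1 hconn).preconnected ⟨w, hw⟩ ⟨u, hu⟩
      exact this.map (⟨Subtype.val, fun h => h⟩ : C.coe →g C.spanningCoe)
    have hw2 : w ∈ p.toSubgraph.verts := by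
      rw [hpv]
      exact SimpleGraph.ConnectedComponent.sound hr
    rw [SimpleGraph.Walk.mem_verts_toSubgraph] at hw2
    rw [SimpleGraph.Walk.mem_support_iff] at hw2
    rcases hw2 with rfl | h
    · have : l[l.length - 1]'(by omega) = w := by
        rw [hget, hll, show p.length - 1 + 1 = p.length by omega, SimpleGraph.Walk.getVert_length]
      rw [← this]
      exact List.getElem_mem _
    · exact h
  refine ⟨l.formPerm, List.isCycle_formPerm hnd (by omega), ?_, hadj, ?_⟩
  · apply Set.Subset.antisymm
    · intro w hw
      exact C.edge_vert (hadj w hw)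
    · intro w hw
      rw [hsupp]
      simpa using hmem w hw
  · obtain ⟨i, hi, hiu⟩ := List.getElem_of_mem (hmem u hu)
    have h2 := List.formPerm_pow_apply_getElem l hnd 2 i hi
    rw [hiu, pow_two, Equiv.Perm.mul_apply] at h2
    rw [h2, ← hiu]
    intro h3
    rw [hnd.getElem_inj_iff] at h3
    by_cases h4 : i + 2 < l.length
    · rw [Nat.mod_eq_of_lt h4] at h3; omega
    · rw [Nat.mod_eq_sub_mod (by omega), Nat.mod_eq_of_lt (by omega)] at h3; omega

theorem permSub_eq {W : Type*} [Fintype W] [DecidableEq W] (G : SimpleGraph W)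
    (C : G.Subgraph) (hC : IsCycleSub G C) (τ : Equiv.Perm W) (hc : τ.IsCycle)
    (hs : (τ.support : Set W) = C.verts) (hadj : ∀ i ∈ τ.support, C.Adj i (τ i))
    {u : W} (hu : τ (τ u) ≠ u) : permSub G τ = C := by
  have hadjG : ∀ i ∈ τ.support, G.Adj i (τ i) := fun i hi => C.adj_sub (hadj i hi)
  have hN : ∀ a ∈ C.verts, (permSub G τ).neighborSet a = C.neighborSet a := by
    intro a ha
    have ha' : a ∈ τ.support := by rw [← hs] at ha; exact ha
    apply Set.eq_of_subset_of_ncard_le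
    · intro b hb
      obtain ⟨_, h | h⟩ := hb
      · subst h; exact hadj a ha'
      · subst h
        exact (hadj b (Equiv.Perm.apply_mem_support.1 ha')).symm
    · rw [hC.2.2 a ha, permSub_nbr G τ hadjG a ha', Set.ncard_pair (aux_sq_ne τ hc hu a ha')]
    · exact Set.toFinite _
  apply SimpleGraph.Subgraph.ext
  · exact hs
  · funext a b
    apply propext
    constructor
    · intro h
      have ha : a ∈ C.verts := hs ▸ (permSub G τ).edge_vert h
      have : b ∈ (permSub G τ).neighborSet a := h
      rw [hN a ha] at this
      exact this
    · intro h
      have ha : a ∈ C.verts := C.edge_vert h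
      have : b ∈ C.neighborSet a := h
      rw [← hN a ha] at this
      exact this

theorem permSub_surjOn {W : Type*} [Fintype W] [DecidableEq W] (G : SimpleGraph W)
    (u v : W) : Set.SurjOn (permSub G) (dirCycles G u v)
      {C : G.Subgraph | IsCycleSub G C ∧ C.Adj u v} := by
  rintro C ⟨hC, hA⟩
  have huC : u ∈ C.verts := C.edge_vert hA
  obtain ⟨τ, hc, hs, hadj, hne⟩ := aux_exists_perm G C hC u huC
  have hE := permSub_eq G C hC τ hc hs hadj hne
  have hadjG : ∀ i ∈ τ.support, G.Adj i (τ i) := fun i hi => C.adj_sub (hadj i hi)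
  have hA' : (permSub G τ).Adj u v := hE ▸ hA
  rcases hA'.2 with h | h
  · exact ⟨τ, ⟨hc, h, h ▸ hne, hadjG⟩, hE⟩
  · have hiu : τ⁻¹ u = v := by rw [← h]; simp
    have hadj' : ∀ i ∈ (τ⁻¹).support, C.Adj i (τ⁻¹ i) := by
      intro i hi
      rw [Equiv.Perm.support_inv] at hi
      have hi' : τ⁻¹ i ∈ τ.support := by
        apply Equiv.Perm.apply_mem_support.1
        simpa using hi
      have := hadj _ hi'
      rw [show τ (τ⁻¹ i) = i by simp] at this
      exact this.symm
    have hne' : τ⁻¹ (τ⁻¹ u) ≠ u := by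
      intro h3
      apply hne
      rw [Equiv.Perm.inv_eq_iff_eq, Equiv.Perm.inv_eq_iff_eq] at h3
      exact h3.symm
    refine ⟨τ⁻¹, ⟨hc.inv, hiu, hiu ▸ hne', fun i hi => C.adj_sub (hadj' i hi)⟩, ?_⟩
    exact permSub_eq G C hC τ⁻¹ hc.inv (by rw [Equiv.Perm.support_inv]; exact hs) hadj' hne'

theorem aux_per_inst {W R : Type*} [CommRing R] (M : Matrix W W R) (S T : Set W) (h : S = T)
    [Fintype {w : W // w ∉ S}] [DecidableEq {w : W // w ∉ S}]
    [Fintype {w : W // w ∉ T}] [DecidableEq {w : W // w ∉ T}] :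
    (delSub M S).per = (delSub M T).per := by
  subst h
  congr!

theorem aux_sum_cycles {W R : Type*} [Fintype W] [DecidableEq W] [CommRing R]
    (G : SimpleGraph W) [DecidableRel G.Adj] (M : Matrix W W R)
    (hM : ∀ i j, i ≠ j → M i j = if G.Adj i j then 1 else 0) (u v : W) (huv : u ≠ v) :
    (∑ σ : Equiv.Perm W, if (σ u = v ∧ σ v ≠ u) then ∏ i, M i (σ i) else 0) =
      ∑ᶠ C ∈ {C : G.Subgraph | IsCycleSub G C ∧ C.Adj u v}, (delSub M C.verts).per := by
  rw [aux_sum_dir G M (fun i j h => by rw [hM i j h]; congr!) u v huv]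
  rw [← finsum_mem_coe_finset]
  refine finsum_mem_eq_of_bijOn (permSub G) ?_ ?_
  · have : (↑(Finset.univ.filter (fun τ => τ ∈ dirCycles G u v)) : Set (Equiv.Perm W))
        = dirCycles G u v := by ext; simp
    rw [this]
    exact ⟨fun τ hτ => permSub_isCycle G u v huv τ hτ, permSub_injOn G u v huv,
      permSub_surjOn G u v⟩
  · intro τ _
    exact aux_per_inst M (τ.support : Set W) (permSub G τ).verts rfl

theorem aux_psi_delSub {W : Type*} [Fintype W] [DecidableEq W]
    (L : Matrix W W (Polynomial ℤ)) (S : Set W)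
    [Fintype {w : W // w ∉ S}] [DecidableEq {w : W // w ∉ S}] :
    psi (delSub L S) =
      (delSub ((Polynomial.X : Polynomial ℤ) • (1 : Matrix W W (Polynomial ℤ)) - L) S).per := by
  unfold psi
  congr 1
  ext i j
  simp [delSub, Matrix.one_apply, Subtype.ext_iff]

theorem aux_expand {W R : Type*} [Fintype W] [DecidableEq W] [CommRing R]
    (M M' : Matrix W W R) (u v : W) (huv : u ≠ v)
    (huu : M u u = M' u u - 1) (hvv : M v v = M' v v - 1)
    (huv1 : M u v = 1) (hvu1 : M v u = 1) (huv0 : M' u v = 0) (hvu0 : M' v u = 0)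
    (hrow : ∀ i j, i ≠ u → i ≠ v → M i j = M' i j)
    (hu : ∀ j, j ≠ u → j ≠ v → M u j = M' u j) (hv : ∀ j, j ≠ u → j ≠ v → M v j = M' v j) :
    M.per = M'.per - (delSub M' {v}).per - (delSub M' {u}).per + 2 * (delSub M {u, v}).per
      + (∑ σ : Equiv.Perm W, if (σ u = v ∧ σ v ≠ u) then ∏ i, M i (σ i) else 0)
      + (∑ σ : Equiv.Perm W, if (σ v = u ∧ σ u ≠ v) then ∏ i, M i (σ i) else 0) := by
  have t1 := aux_per_delSub M' {v} 1 (fun i _ => rfl)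
  have t2 := aux_per_delSub M' {u} 1 (fun i _ => rfl)
  have t3 := aux_per_delSub M {u, v} 1 (fun i _ => rfl)
  have t4 := aux_per_delSub M {u, v} (Equiv.swap u v) (fun i hi => by
    simp only [Set.mem_insert_iff, Set.mem_singleton_iff, not_or] at hi
    exact Equiv.swap_apply_of_ne_of_ne hi.1 hi.2)
  rw [two_mul]
  nth_rw 1 [← t3]
  rw [← t1, ← t2, ← t4, Matrix.per, Matrix.per, ← Finset.sum_sub_distrib, ← Finset.sum_sub_distrib,
    ← Finset.sum_add_distrib, ← Finset.sum_add_distrib, ← Finset.sum_add_distrib,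
    ← Finset.sum_add_distrib]
  refine Finset.sum_congr rfl fun σ _ => ?_
  simp only [Set.mem_insert_iff, Set.mem_singleton_iff, forall_eq_or_imp, forall_eq,
    Equiv.Perm.one_apply, Equiv.swap_apply_left, Equiv.swap_apply_right]
  have hP : ∀ N : Matrix W W R, ∏ i, N i (σ i) =
      N u (σ u) * (N v (σ v) * ∏ i ∈ Finset.univ.filter (fun i => ¬ (i = u ∨ i = v)),
        N i (σ i)) := by
    intro N
    rw [← Finset.mul_prod_erase Finset.univ _ (Finset.mem_univ u),
      ← Finset.mul_prod_erase (Finset.univ.erase u) _ (a := v) (by simp [huv.symm])]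
    congr 2
    refine Finset.prod_congr ?_ fun _ _ => rfl
    ext i; simp; tauto
  have hPu : ∏ i ∈ Finset.univ.filter (fun i => ¬ (i = u)), M' i (σ i) =
      (M' v (σ v) * ∏ i ∈ Finset.univ.filter (fun i => ¬ (i = u ∨ i = v)), M' i (σ i)) := by
    rw [← Finset.mul_prod_erase _ _ (a := v) (by simp [huv.symm])]
    congr 1
    refine Finset.prod_congr ?_ fun _ _ => rfl
    ext i; simp; tauto
  have hPv : ∏ i ∈ Finset.univ.filter (fun i => ¬ (i = v)), M' i (σ i) =
      (M' u (σ u) * ∏ i ∈ Finset.univ.filter (fun i => ¬ (i = u ∨ i = v)), M' i (σ i)) := by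
    rw [← Finset.mul_prod_erase _ _ (a := u) (by simp [huv])]
    congr 1
    refine Finset.prod_congr ?_ fun _ _ => rfl
    ext i; simp
  have hMM : ∏ i ∈ Finset.univ.filter (fun i => ¬ (i = u ∨ i = v)), M i (σ i) =
      ∏ i ∈ Finset.univ.filter (fun i => ¬ (i = u ∨ i = v)), M' i (σ i) := by
    refine Finset.prod_congr rfl fun i hi => ?_
    simp only [Finset.mem_filter, Finset.mem_univ, true_and, not_or] at hi
    exact hrow i _ hi.1 hi.2
  rw [hP M, hP M', hPu, hPv, hMM]
  generalize ∏ i ∈ Finset.univ.filter (fun i => ¬ (i = u ∨ i = v)), M' i (σ i) = P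
  have hinj : σ u ≠ σ v := fun h => huv (σ.injective h)
  have ca : M u (σ u) = M' u (σ u) - (if σ u = u then 1 else 0) + (if σ u = v then 1 else 0) := by
    by_cases h1 : σ u = u
    · rw [h1]; simp [huv, huu]
    · by_cases h2 : σ u = v
      · rw [h2]; simp [huv.symm, huv1, huv0]
      · simp [h1, h2, hu _ h1 h2]
  have cb : M v (σ v) = M' v (σ v) - (if σ v = v then 1 else 0) + (if σ v = u then 1 else 0) := by
    by_cases h1 : σ v = v
    · rw [h1]; simp [huv.symm, hvv]
    · by_cases h2 : σ v = u
      · rw [h2]; simp [huv, hvu1, hvu0]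
      · simp [h1, h2, hv _ h2 h1]
  have da : σ u = v → M' u (σ u) = 0 := fun h => by rw [h, huv0]
  have db : σ v = u → M' v (σ v) = 0 := fun h => by rw [h, hvu0]
  rw [ca, cb]
  by_cases q : σ u = v
  · have nq : σ u ≠ u := by rw [q]; exact huv.symm
    have nr : σ v ≠ v := by intro h; exact hinj (q.trans h.symm)
    rw [da q]
    by_cases s : σ v = u
    · rw [db s]; simp [q, s, huv, huv.symm]
    · simp [q, s, nr, huv.symm]
  · by_cases s : σ v = u
    · have nq : σ u ≠ u := fun h => hinj (h.trans s.symm)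
      rw [db s]; simp [q, s, nq, huv]
    · by_cases p : σ u = u <;> by_cases r : σ v = v <;> simp [p, q, r, s, huv, huv.symm] <;> ring

theorem laplacian_permanental_edge_recursion
    {V : Type*} [Fintype V] [DecidableEq V]
    (G : SimpleGraph V) [DecidableRel G.Adj] (u v : V) (he : G.Adj u v) :
    psi (lapMat (Polynomial ℤ) G) =
      psi (lapMat (Polynomial ℤ) (G.deleteEdges {s(u, v)}))
        - psi (delSub (lapMat (Polynomial ℤ) (G.deleteEdges {s(u, v)})) {v})
        - psi (delSub (lapMat (Polynomial ℤ) (G.deleteEdges {s(u, v)})) {u})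
        + 2 * psi (delSub (lapMat (Polynomial ℤ) G) {u, v})
        + 2 * ∑ᶠ C ∈ {C : G.Subgraph | IsCycleSub G C ∧ C.Adj u v},
          psi (delSub (lapMat (Polynomial ℤ) G) C.verts) := by
  have huv : u ≠ v := he.ne
  have hdu : (G.degree u : ℤ[X]) = ((G.deleteEdges {s(u, v)}).degree u : ℤ[X]) + 1 := by
    have e : (G.deleteEdges {s(u, v)}).neighborFinset u = (G.neighborFinset u).erase v := by
      ext w
      simp only [SimpleGraph.mem_neighborFinset, SimpleGraph.deleteEdges_adj, Finset.mem_erase,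
        Set.mem_singleton_iff, Sym2.eq_iff]
      grind
    rw [← SimpleGraph.card_neighborFinset_eq_degree, ← SimpleGraph.card_neighborFinset_eq_degree, e,
      ← Finset.card_erase_add_one (a := v) (s := G.neighborFinset u) (by simp [he, he.symm])]
    push_cast
    rfl
  have hdv : (G.degree v : ℤ[X]) = ((G.deleteEdges {s(u, v)}).degree v : ℤ[X]) + 1 := by
    have e : (G.deleteEdges {s(u, v)}).neighborFinset v = (G.neighborFinset v).erase u := by
      ext w
      simp only [SimpleGraph.mem_neighborFinset, SimpleGraph.deleteEdges_adj, Finset.mem_erase,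
        Set.mem_singleton_iff, Sym2.eq_iff]
      grind
    rw [← SimpleGraph.card_neighborFinset_eq_degree, ← SimpleGraph.card_neighborFinset_eq_degree, e,
      ← Finset.card_erase_add_one (a := u) (s := G.neighborFinset v) (by simp [he, he.symm])]
    push_cast
    rfl
  have hd : ∀ w, w ≠ u → w ≠ v → G.degree w = (G.deleteEdges {s(u, v)}).degree w := by
    intro w h1 h2
    have e : (G.deleteEdges {s(u, v)}).neighborFinset w = G.neighborFinset w := by
      ext x
      simp only [SimpleGraph.mem_neighborFinset, SimpleGraph.deleteEdges_adj,
        Set.mem_singleton_iff, Sym2.eq_iff]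
      grind
    rw [← SimpleGraph.card_neighborFinset_eq_degree, ← SimpleGraph.card_neighborFinset_eq_degree, e]
  simp only [aux_psi_delSub]
  unfold psi
  set M := (Polynomial.X : Polynomial ℤ) • (1 : Matrix V V (Polynomial ℤ)) -
    lapMat (Polynomial ℤ) G with hM
  set M' := (Polynomial.X : Polynomial ℤ) • (1 : Matrix V V (Polynomial ℤ)) -
    lapMat (Polynomial ℤ) (G.deleteEdges {s(u, v)}) with hM'
  have eM : ∀ i j, M i j = (if i = j then X - (G.degree i : ℤ[X]) else 0) +
      (if G.Adj i j then 1 else 0) := by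
    intro i j
    by_cases h : i = j
    · subst h
      simp [hM, lapMat, degMat]
    · simp [hM, lapMat, degMat, h]
  have eM' : ∀ i j, M' i j = (if i = j then X - ((G.deleteEdges {s(u, v)}).degree i : ℤ[X]) else 0)
      + (if (G.deleteEdges {s(u, v)}).Adj i j then 1 else 0) := by
    intro i j
    by_cases h : i = j
    · subst h
      simp [hM', lapMat, degMat]
    · simp [hM', lapMat, degMat, h]
  have hMadj : ∀ i j, i ≠ j → M i j = if G.Adj i j then 1 else 0 := by
    intro i j h
    rw [eM]; simp [h]
  rw [aux_expand M M' u v huv, aux_sum_cycles G M hMadj u v huv,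
    aux_sum_cycles G M hMadj v u huv.symm]
  · have hset : {C : G.Subgraph | IsCycleSub G C ∧ C.Adj v u} =
        {C : G.Subgraph | IsCycleSub G C ∧ C.Adj u v} := by
      ext C
      exact and_congr_right fun _ => ⟨fun h => h.symm, fun h => h.symm⟩
    rw [hset, add_assoc, ← two_mul]
  · rw [eM, eM', hdu]; simp; ring
  · rw [eM, eM', hdv]; simp; ring
  · rw [eM]; simp [huv, he]
  · rw [eM]; simp [huv.symm, he.symm]
  · rw [eM']; simp [huv]
  · rw [eM']; simp [huv.symm]
  · intro i j h1 h2
    rw [eM, eM', hd i h1 h2]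
    simp [h1, h2]
  · intro j h1 h2
    rw [eM, eM']
    simp [h1.symm, h2, h1]
  · intro j h1 h2
    rw [eM, eM']
    simp [h2.symm, h2, h1]
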